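/- For every integer k ≥ t₀, every vertex v ∈ V, and every weight configuration ℓ : E → ℕ with ℓ(e) ≥ ℓ₀(e) for all e ∈ E and ∑_{e∈E} ℓ(e) = k, one has P^𝒢( X_k^e = ℓ(e) for all e ∈ E, and I_k = v ) ≤ ( ∏_{e∈E} w(ℓ₀(e)) / min_{e∈𝒩_{v₀}} w(ℓ₀(e)) ) · ( ∑_{e∈𝒩_v} w(ℓ(e)) / ∏_{e∈E} w(ℓ(e)) ). -/

import Mathlib

/-!
Statement 19 (Proposition 19 of Cotar–Limic).  `w : ℕ → ℝ` is a positive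
reinforcement weight function on `{1,2,...}`.  `𝒢` is a finite connected
(simple) graph with initial edge weights `ℓ₀` (≥ 1 on edges), initial position
`v₀` and initial time `t₀ := ∑_{e} ℓ₀(e)`.  The ERRW on `𝒢` is encoded by its
trajectory of positions `p : ℕ → V` (with `p n` the position at time `t₀ + n`);
`Xw p n e` is the weight of the edge `e` after `n` steps, and the law `P^𝒢` is
characterized by its cylinder probabilities.
-/

open MeasureTheory Finset

namespace AttractionTimeGraph

variable {V : Type*} [Fintype V] [DecidableEq V]

/-- Weight of the edge `e` after `n` steps of the trajectory `p`. -/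
def Xw (ℓ₀ : Sym2 V → ℕ) (p : ℕ → V) (n : ℕ) (e : Sym2 V) : ℕ :=
  ℓ₀ e + ((Finset.range n).filter fun j => s(p j, p (j + 1)) = e).card

/-- Transition probability of the `n`-th step of the trajectory `p`: if the
step traverses an edge `{u, v}` of `𝒢`, it is `w`-proportional to the current
weight of `{u, v}` among the edges incident to `u`; otherwise it is `0`. -/
noncomputable def stepProb (w : ℕ → ℝ) (G : SimpleGraph V) [DecidableRel G.Adj]
    (ℓ₀ : Sym2 V → ℕ) (p : ℕ → V) (n : ℕ) : ℝ :=
  if G.Adj (p n) (p (n + 1)) then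
    w (Xw ℓ₀ p n s(p n, p (n + 1))) /
      ∑ y ∈ G.neighborFinset (p n), w (Xw ℓ₀ p n s(p n, y))
  else 0

end AttractionTimeGraph

open AttractionTimeGraph

namespace AttractionTimeGraph

variable {V : Type*} [DecidableEq V]

lemma Xw_zero (ℓ₀ : Sym2 V → ℕ) (p : ℕ → V) (e : Sym2 V) : Xw ℓ₀ p 0 e = ℓ₀ e := by
  simp [Xw]

lemma Xw_succ (ℓ₀ : Sym2 V → ℕ) (p : ℕ → V) (n : ℕ) (e : Sym2 V) :
    Xw ℓ₀ p (n + 1) e = Xw ℓ₀ p n e + if s(p n, p (n + 1)) = e then 1 else 0 := by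
  unfold Xw
  rw [Finset.range_add_one, Finset.filter_insert]
  split_ifs
  · rw [Finset.card_insert_of_notMem (by simp)]
    ring
  · rfl

lemma le_Xw (ℓ₀ : Sym2 V → ℕ) (p : ℕ → V) (n : ℕ) (e : Sym2 V) : ℓ₀ e ≤ Xw ℓ₀ p n e :=
  Nat.le_add_right _ _

lemma Xw_congr (ℓ₀ : Sym2 V → ℕ) {p q : ℕ → V} {n : ℕ} (h : ∀ i ≤ n, p i = q i)
    (e : Sym2 V) : Xw ℓ₀ p n e = Xw ℓ₀ q n e := by
  unfold Xw
  congr 2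
  refine Finset.filter_congr fun j hj => ?_
  have hj := Finset.mem_range.1 hj
  rw [h j (by omega), h (j + 1) (by omega)]

/-- The walk sits at `v` with edge weights `ℓ` after `n` steps. -/
def stateEvent (G : SimpleGraph V) (ℓ₀ ℓ : Sym2 V → ℕ) (n : ℕ) (v : V) : Set (ℕ → V) :=
  {p | p n = v ∧ ∀ e ∈ G.edgeSet, Xw ℓ₀ p n e = ℓ e}

lemma mem_stateEvent_congr {G : SimpleGraph V} {ℓ₀ ℓ : Sym2 V → ℕ} {n : ℕ} {v : V}
    (p q : ℕ → V) (h : ∀ i ≤ n, p i = q i) (hp : p ∈ stateEvent G ℓ₀ ℓ n v) :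
    q ∈ stateEvent G ℓ₀ ℓ n v :=
  ⟨(h n le_rfl).symm.trans hp.1, fun e he => (Xw_congr ℓ₀ h e).symm.trans (hp.2 e he)⟩

variable [Fintype V]

lemma sum_incidenceFinset (G : SimpleGraph V) [DecidableRel G.Adj] (v : V)
    (f : Sym2 V → ℝ) :
    ∑ e ∈ G.incidenceFinset v, f e = ∑ y ∈ G.neighborFinset v, f s(v, y) := by
  have himg : G.incidenceFinset v = (G.neighborFinset v).image fun y => s(v, y) := by
    ext e
    induction e with | _ a b
    simp only [SimpleGraph.mem_incidenceFinset, SimpleGraph.mk'_mem_incidenceSet_iff,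
      Finset.mem_image, SimpleGraph.mem_neighborFinset, Sym2.eq_iff]
    constructor
    · rintro ⟨h, rfl | rfl⟩
      · exact ⟨b, h, Or.inl ⟨rfl, rfl⟩⟩
      · exact ⟨a, h.symm, Or.inr ⟨rfl, rfl⟩⟩
    · rintro ⟨y, h, ⟨rfl, rfl⟩ | ⟨rfl, rfl⟩⟩
      · exact ⟨h, Or.inl rfl⟩
      · exact ⟨h.symm, Or.inr rfl⟩
  rw [himg, Finset.sum_image]
  intro a _ b _ h
  exact Sym2.congr_right.1 h

section Measure

variable [MeasurableSpace V] [MeasurableSingletonClass V]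

/-- If `B` depends only on the first `n` steps and on `B` the next step goes to `v` with
probability `c`, then this step contributes a factor `c`. -/
lemma measureReal_inter_next {w : ℕ → ℝ} {G : SimpleGraph V} [DecidableRel G.Adj]
    {ℓ₀ : Sym2 V → ℕ} {v₀ : V} {P : Measure (ℕ → V)} [IsProbabilityMeasure P]
    (hstart : P {p | p 0 ≠ v₀} = 0)
    (hP : ∀ (m : ℕ) (q : ℕ → V), q 0 = v₀ →
      (P {p | ∀ i ≤ m, p i = q i}).toReal =
        ∏ i ∈ Finset.range m, stepProb w G ℓ₀ q i)
    {n : ℕ} {v : V} {c : ℝ} {B : Set (ℕ → V)}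
    (hB : ∀ p q : ℕ → V, (∀ i ≤ n, p i = q i) → p ∈ B → q ∈ B)
    (hc : ∀ q ∈ B, q (n + 1) = v → stepProb w G ℓ₀ q n = c) :
    P.real (B ∩ {p | p (n + 1) = v}) = P.real B * c := by
  let R : (ℕ → V) → (Fin (n + 1) → V) := fun p i => p i
  have hR : Measurable R := measurable_pi_lambda _ fun i => measurable_pi_apply _
  have hsplit (A : Set (ℕ → V)) : P.real A = ∑ r, P.real (A ∩ R ⁻¹' {r}) := by
    have h := sum_measureReal_preimage_singleton (μ := P.restrict A) (f := R) Finset.univ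
      (fun r _ => hR (measurableSet_singleton r))
    rw [Finset.coe_univ, Set.preimage_univ, measureReal_restrict_apply_univ] at h
    rw [← h]
    refine Finset.sum_congr rfl fun r _ => ?_
    rw [measureReal_restrict_apply (hR (measurableSet_singleton r)), Set.inter_comm]
  rw [hsplit, hsplit B, Finset.sum_mul]
  refine Finset.sum_congr rfl fun r _ => ?_
  rcases (B ∩ R ⁻¹' {r}).eq_empty_or_nonempty with he | ⟨q, hqB, hqr⟩
  · rw [Set.inter_right_comm, he]
    simp
  let q' := Function.update q (n + 1) v
  have hq' (i : ℕ) (hi : i ≤ n) : q' i = q i := Function.update_of_ne (by omega) _ _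
  have hq'v : q' (n + 1) = v := Function.update_self _ _ _
  have hq'B : q' ∈ B := hB q q' (fun i hi => (hq' i hi).symm) hqB
  have hmem (p : ℕ → V) : p ∈ R ⁻¹' {r} ↔ ∀ i ≤ n, p i = q' i := by
    have hqr : R q = r := hqr
    rw [Set.mem_preimage, Set.mem_singleton_iff, ← hqr, funext_iff]
    constructor
    · intro h i hi
      rw [hq' i hi]
      exact h ⟨i, by omega⟩
    · intro h i
      have := h i (by omega)
      rwa [hq' i (by omega)] at this
  have hcyl : B ∩ R ⁻¹' {r} = {p | ∀ i ≤ n, p i = q' i} := by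
    ext p
    rw [Set.mem_inter_iff, hmem, Set.mem_ofPred_eq]
    exact ⟨fun h => h.2, fun h => ⟨hB q' p (fun i hi => (h i hi).symm) hq'B, h⟩⟩
  have hcyl' : B ∩ {p | p (n + 1) = v} ∩ R ⁻¹' {r} = {p | ∀ i ≤ n + 1, p i = q' i} := by
    rw [Set.inter_right_comm, hcyl]
    ext p
    constructor
    · rintro ⟨h1, h2⟩ i hi
      rcases Nat.le_succ_iff.1 hi with h | rfl
      · exact h1 i h
      · exact h2.trans hq'v.symm
    · intro h
      exact ⟨fun i hi => h i (by omega), (h (n + 1) le_rfl).trans hq'v⟩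
  rw [hcyl, hcyl']
  by_cases h0 : q' 0 = v₀
  · rw [measureReal_def, measureReal_def, hP _ _ h0, hP _ _ h0, Finset.prod_range_succ,
      hc q' hq'B hq'v]
  · have hnull (m : ℕ) : P.real {p | ∀ i ≤ m, p i = q' i} = 0 := by
      rw [measureReal_def, measure_mono_null (fun p hp => ?_) hstart, ENNReal.toReal_zero]
      rw [Set.mem_ofPred_eq, hp 0 (Nat.zero_le _)]
      exact h0
    rw [hnull, hnull, zero_mul]

lemma measureReal_last_edge_le {w : ℕ → ℝ} (hw : ∀ k, 1 ≤ k → 0 < w k)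
    {G : SimpleGraph V} [DecidableRel G.Adj]
    {ℓ₀ : Sym2 V → ℕ} (hℓ₀ : ∀ e ∈ G.edgeSet, 1 ≤ ℓ₀ e) {v₀ : V}
    {P : Measure (ℕ → V)} [IsProbabilityMeasure P]
    (hstart : P {p | p 0 ≠ v₀} = 0)
    (hP : ∀ (m : ℕ) (q : ℕ → V), q 0 = v₀ →
      (P {p | ∀ i ≤ m, p i = q i}).toReal =
        ∏ i ∈ Finset.range m, stepProb w G ℓ₀ q i)
    {C : ℝ} (hC : 0 ≤ C) {n : ℕ}
    (ih : ∀ (u : V) (ℓ : Sym2 V → ℕ), (∀ e ∈ G.edgeSet, ℓ₀ e ≤ ℓ e) →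
      P.real (stateEvent G ℓ₀ ℓ n u) ≤
        C * ((∑ e ∈ G.incidenceFinset u, w (ℓ e)) / ∏ e ∈ G.edgeFinset, w (ℓ e)))
    {u v : V} (huv : G.Adj u v) {ℓ : Sym2 V → ℕ} (hge : ∀ e ∈ G.edgeSet, ℓ₀ e ≤ ℓ e) :
    P.real (stateEvent G ℓ₀ ℓ (n + 1) v ∩ {p | p n = u}) ≤
      C * (w (ℓ s(u, v)) / ∏ e ∈ G.edgeFinset, w (ℓ e)) := by
  have huvE : s(u, v) ∈ G.edgeSet := huv
  have hpos (ℓ : Sym2 V → ℕ) (h : ∀ e ∈ G.edgeSet, ℓ₀ e ≤ ℓ e) (e : Sym2 V)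
      (he : e ∈ G.edgeSet) : 0 < w (ℓ e) := hw _ ((hℓ₀ e he).trans (h e he))
  have hprod (ℓ : Sym2 V → ℕ) (h : ∀ e ∈ G.edgeSet, ℓ₀ e ≤ ℓ e) :
      0 < ∏ e ∈ G.edgeFinset, w (ℓ e) :=
    Finset.prod_pos fun e he => hpos ℓ h e (SimpleGraph.mem_edgeFinset.1 he)
  have hstep (p : ℕ → V) (hp : p ∈ stateEvent G ℓ₀ ℓ (n + 1) v ∩ {p | p n = u})
      (e : Sym2 V) (he : e ∈ G.edgeSet) :
      Xw ℓ₀ p n e + (if s(u, v) = e then 1 else 0) = ℓ e := by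
    obtain ⟨⟨h1, h2⟩, h3⟩ := hp
    rw [← h2 e he, Xw_succ, h1, show p n = u from h3]
  by_cases hlt : ℓ₀ s(u, v) < ℓ s(u, v)
  · set ℓ' : Sym2 V → ℕ := Function.update ℓ s(u, v) (ℓ s(u, v) - 1) with hℓ'
    have hself : ℓ' s(u, v) = ℓ s(u, v) - 1 := Function.update_self _ _ _
    have hother (e : Sym2 V) (he : e ≠ s(u, v)) : ℓ' e = ℓ e := Function.update_of_ne he _ _
    have hge' : ∀ e ∈ G.edgeSet, ℓ₀ e ≤ ℓ' e := by
      intro e he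
      rcases eq_or_ne e s(u, v) with rfl | hne
      · omega
      · rw [hother e hne]
        exact hge e he
    set S := ∑ e ∈ G.incidenceFinset u, w (ℓ' e) with hS
    have hSpos : 0 < S := by
      refine Finset.sum_pos (fun e he => ?_) ⟨s(u, v), ?_⟩
      · exact hpos ℓ' hge' e (G.mem_incidenceFinset _ e |>.1 he).1
      · rw [SimpleGraph.mem_incidenceFinset]
        exact ⟨huv, Sym2.mem_mk_left u v⟩
    have hsub : stateEvent G ℓ₀ ℓ (n + 1) v ∩ {p | p n = u} ⊆
        stateEvent G ℓ₀ ℓ' n u ∩ {p | p (n + 1) = v} := by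
      intro p hp
      refine ⟨⟨hp.2, fun e he => ?_⟩, hp.1.1⟩
      have h := hstep p hp e he
      rcases eq_or_ne e s(u, v) with rfl | hne
      · rw [if_pos rfl] at h
        omega
      · rw [if_neg hne.symm] at h
        rw [hother e hne]
        exact h
    have hnext : P.real (stateEvent G ℓ₀ ℓ' n u ∩ {p | p (n + 1) = v}) =
        P.real (stateEvent G ℓ₀ ℓ' n u) * (w (ℓ' s(u, v)) / S) := by
      refine measureReal_inter_next hstart hP mem_stateEvent_congr ?_
      rintro q ⟨hqu, hqX⟩ hqv
      rw [stepProb, hqu, hqv, if_pos huv, hqX _ huvE, hS, sum_incidenceFinset]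
      congr 1
      refine Finset.sum_congr rfl fun y hy => ?_
      rw [hqX _ ((SimpleGraph.mem_neighborFinset _ _ _).1 hy)]
    have hprods : (∏ e ∈ G.edgeFinset, w (ℓ' e)) * w (ℓ s(u, v)) =
        w (ℓ' s(u, v)) * ∏ e ∈ G.edgeFinset, w (ℓ e) := by
      have hm : s(u, v) ∈ G.edgeFinset := SimpleGraph.mem_edgeFinset.2 huvE
      rw [← Finset.mul_prod_erase _ _ hm, ← Finset.mul_prod_erase _ (fun e => w (ℓ e)) hm,
        Finset.prod_congr rfl fun e he => by rw [hother e (Finset.ne_of_mem_erase he)]]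
      ring
    have h1 := hprod ℓ hge
    have h2 := hprod ℓ' hge'
    have h3 := hpos ℓ' hge' _ huvE
    calc P.real (stateEvent G ℓ₀ ℓ (n + 1) v ∩ {p | p n = u})
        ≤ P.real (stateEvent G ℓ₀ ℓ' n u) * (w (ℓ' s(u, v)) / S) :=
          (measureReal_mono hsub).trans hnext.le
      _ ≤ C * (S / ∏ e ∈ G.edgeFinset, w (ℓ' e)) * (w (ℓ' s(u, v)) / S) :=
          mul_le_mul_of_nonneg_right (ih u ℓ' hge') (by positivity)
      _ = C * (w (ℓ' s(u, v)) / ∏ e ∈ G.edgeFinset, w (ℓ' e)) := by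
          field_simp
      _ = C * (w (ℓ s(u, v)) / ∏ e ∈ G.edgeFinset, w (ℓ e)) := by
          congr 1
          rw [div_eq_div_iff h2.ne' h1.ne', ← hprods, mul_comm]
  · have hempty : stateEvent G ℓ₀ ℓ (n + 1) v ∩ {p | p n = u} = ∅ := by
      refine Set.eq_empty_of_forall_notMem fun p hp => ?_
      have h := hstep p hp _ huvE
      have := le_Xw ℓ₀ p n s(u, v)
      rw [if_pos rfl] at h
      omega
    rw [hempty, measureReal_empty]
    exact mul_nonneg hC (div_nonneg (hpos ℓ hge _ huvE).le (hprod ℓ hge).le)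

lemma measureReal_stateEvent_le {w : ℕ → ℝ} (hw : ∀ k, 1 ≤ k → 0 < w k)
    {G : SimpleGraph V} [DecidableRel G.Adj]
    {ℓ₀ : Sym2 V → ℕ} (hℓ₀ : ∀ e ∈ G.edgeSet, 1 ≤ ℓ₀ e) {v₀ : V}
    {P : Measure (ℕ → V)} [IsProbabilityMeasure P]
    (hstart : P {p | p 0 ≠ v₀} = 0)
    (hP : ∀ (m : ℕ) (q : ℕ → V), q 0 = v₀ →
      (P {p | ∀ i ≤ m, p i = q i}).toReal =
        ∏ i ∈ Finset.range m, stepProb w G ℓ₀ q i)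
    {C : ℝ} (hC : 0 ≤ C)
    (hinit : 1 ≤ C * ((∑ e ∈ G.incidenceFinset v₀, w (ℓ₀ e)) / ∏ e ∈ G.edgeFinset, w (ℓ₀ e)))
    (n : ℕ) (v : V) (ℓ : Sym2 V → ℕ) (hge : ∀ e ∈ G.edgeSet, ℓ₀ e ≤ ℓ e) :
    P.real (stateEvent G ℓ₀ ℓ n v) ≤
      C * ((∑ e ∈ G.incidenceFinset v, w (ℓ e)) / ∏ e ∈ G.edgeFinset, w (ℓ e)) := by
  induction n generalizing v ℓ with
  | zero =>
    have hnonneg (e : Sym2 V) (he : e ∈ G.edgeSet) : 0 ≤ w (ℓ e) :=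
      (hw _ ((hℓ₀ e he).trans (hge e he))).le
    by_cases h : v = v₀ ∧ ∀ e ∈ G.edgeSet, ℓ e = ℓ₀ e
    · obtain ⟨rfl, hℓ⟩ := h
      rw [Finset.sum_congr rfl fun e he => by
          rw [hℓ e (G.mem_incidenceFinset _ e |>.1 he).1],
        Finset.prod_congr rfl fun e he => by rw [hℓ e (SimpleGraph.mem_edgeFinset.1 he)]]
      exact measureReal_le_one.trans hinit
    · have hsub : stateEvent G ℓ₀ ℓ 0 v ⊆ {p | p 0 ≠ v₀} := by
        rintro p ⟨h1, h2⟩ h3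
        exact h ⟨h1.symm.trans h3, fun e he => by rw [← h2 e he, Xw_zero]⟩
      rw [measureReal_def, measure_mono_null hsub hstart, ENNReal.toReal_zero]
      refine mul_nonneg hC (div_nonneg (Finset.sum_nonneg fun e he => ?_)
        (Finset.prod_nonneg fun e he => ?_))
      · exact hnonneg e (G.mem_incidenceFinset _ e |>.1 he).1
      · exact hnonneg e (SimpleGraph.mem_edgeFinset.1 he)
  | succ n ih =>
    have hcover : stateEvent G ℓ₀ ℓ (n + 1) v ⊆
        ⋃ u ∈ (Finset.univ : Finset V), stateEvent G ℓ₀ ℓ (n + 1) v ∩ {p | p n = u} := by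
      intro p hp
      simp only [Set.mem_iUnion]
      exact ⟨p n, Finset.mem_univ _, hp, rfl⟩
    have hnonadj (u : V) (hu : ¬ G.Adj u v) :
        P.real (stateEvent G ℓ₀ ℓ (n + 1) v ∩ {p | p n = u}) = 0 := by
      have h : P.real ({p : ℕ → V | p n = u} ∩ {p | p (n + 1) = v}) =
          P.real {p : ℕ → V | p n = u} * 0 := by
        refine measureReal_inter_next hstart hP (fun p q hpq hp => ?_) fun q hqu hqv => ?_
        · exact (hpq n le_rfl).symm.trans hp
        · rw [stepProb, hqv, show q n = u from hqu, if_neg hu]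
      rw [mul_zero] at h
      refine le_antisymm (h ▸ measureReal_mono fun p hp => ⟨hp.2, hp.1.1⟩) measureReal_nonneg
    calc P.real (stateEvent G ℓ₀ ℓ (n + 1) v)
        ≤ ∑ u, P.real (stateEvent G ℓ₀ ℓ (n + 1) v ∩ {p | p n = u}) :=
          (measureReal_mono hcover (measure_ne_top _ _)).trans (measureReal_biUnion_finset_le _ _)
      _ = ∑ u ∈ G.neighborFinset v, P.real (stateEvent G ℓ₀ ℓ (n + 1) v ∩ {p | p n = u}) := by
          refine (Finset.sum_subset (Finset.subset_univ _) fun u _ hu => hnonadj u ?_).symm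
          rwa [SimpleGraph.mem_neighborFinset, G.adj_comm] at hu
      _ ≤ ∑ u ∈ G.neighborFinset v, C * (w (ℓ s(v, u)) / ∏ e ∈ G.edgeFinset, w (ℓ e)) := by
          refine Finset.sum_le_sum fun u hu => ?_
          rw [Sym2.eq_swap]
          exact measureReal_last_edge_le hw hℓ₀ hstart hP hC ih
            ((SimpleGraph.mem_neighborFinset _ _ _).1 hu).symm hge
      _ = C * ((∑ e ∈ G.incidenceFinset v, w (ℓ e)) / ∏ e ∈ G.edgeFinset, w (ℓ e)) := by
          rw [sum_incidenceFinset, Finset.sum_div, Finset.mul_sum]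

end Measure

end AttractionTimeGraph

/-- Proposition 19: for every `k ≥ t₀`, every vertex `v` and
every weight configuration `ℓ` with `ℓ(e) ≥ ℓ₀(e)` on edges and
`∑_e ℓ(e) = k`,
`P^𝒢(X_k^e = ℓ(e) ∀ e, I_k = v)
  ≤ (∏_e w(ℓ₀(e)) / min_{e ∋ v₀} w(ℓ₀(e))) · (∑_{e ∋ v} w(ℓ(e)) / ∏_e w(ℓ(e)))`. -/
theorem stmt19 {V : Type*} [Fintype V] [DecidableEq V]
    [MeasurableSpace V] [MeasurableSingletonClass V]
    (w : ℕ → ℝ) (hw : ∀ k, 1 ≤ k → 0 < w k)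
    (G : SimpleGraph V) [DecidableRel G.Adj] (hconn : G.Connected)
    (ℓ₀ : Sym2 V → ℕ) (hℓ₀ : ∀ e ∈ G.edgeSet, 1 ≤ ℓ₀ e)
    (v₀ : V) (hne : (G.incidenceFinset v₀).Nonempty)
    (t₀ : ℕ) (ht₀ : t₀ = ∑ e ∈ G.edgeFinset, ℓ₀ e)
    (P : Measure (ℕ → V)) [IsProbabilityMeasure P]
    (hstart : P {p | p 0 = v₀} = 1)
    (hP : ∀ (m : ℕ) (q : ℕ → V), q 0 = v₀ →
      (P {p | ∀ i ≤ m, p i = q i}).toReal =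
        ∏ i ∈ Finset.range m, stepProb w G ℓ₀ q i)
    (k : ℕ) (hk : t₀ ≤ k) (v : V) (ℓ : Sym2 V → ℕ)
    (hge : ∀ e ∈ G.edgeSet, ℓ₀ e ≤ ℓ e)
    (hsum : ∑ e ∈ G.edgeFinset, ℓ e = k) :
    (P {p | p (k - t₀) = v ∧
        ∀ e ∈ G.edgeSet, Xw ℓ₀ p (k - t₀) e = ℓ e}).toReal ≤
      (∏ e ∈ G.edgeFinset, w (ℓ₀ e)) /
          (G.incidenceFinset v₀).inf' hne (fun e => w (ℓ₀ e)) *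
        ((∑ e ∈ G.incidenceFinset v, w (ℓ e)) / ∏ e ∈ G.edgeFinset, w (ℓ e)) := by
  have hnull : P {p | p 0 ≠ v₀} = 0 := by
    have hm : MeasurableSet {p : ℕ → V | p 0 = v₀} :=
      (measurable_pi_apply (X := fun _ : ℕ => V) 0) (measurableSet_singleton v₀)
    exact (prob_compl_eq_zero_iff hm).2 hstart
  have hpos (e : Sym2 V) (he : e ∈ G.edgeSet) : 0 < w (ℓ₀ e) := hw _ (hℓ₀ e he)
  have hprod : 0 < ∏ e ∈ G.edgeFinset, w (ℓ₀ e) :=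
    Finset.prod_pos fun e he => hpos e (SimpleGraph.mem_edgeFinset.1 he)
  have hinc (e : Sym2 V) (he : e ∈ G.incidenceFinset v₀) : 0 < w (ℓ₀ e) :=
    hpos e (G.mem_incidenceFinset _ e |>.1 he).1
  have hmin : 0 < (G.incidenceFinset v₀).inf' hne (fun e => w (ℓ₀ e)) :=
    (Finset.lt_inf'_iff hne).2 hinc
  refine measureReal_stateEvent_le hw hℓ₀ hnull hP (div_pos hprod hmin).le ?_ _ v ℓ hge
  rw [div_mul_div_comm, mul_comm, mul_div_mul_right _ _ hprod.ne', one_le_div hmin]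
  obtain ⟨e, he⟩ := hne
  exact (Finset.inf'_le _ he).trans
    (Finset.single_le_sum (f := fun e => w (ℓ₀ e)) (fun e he => (hinc e he).le) he)
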